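/- Let φ : K^T → W have a majority polymorphism, where K, T are finite and nonempty. Then φ can be expressed as a maximum of binary functions: for every labeling x̄ ∈ K^T (with |T| ≥ 2), φ(x̄) = max over pairs i, j ∈ T of φ_{ij}(x_i, x_j), where φ_{ij} is the projection of φ onto {i, j}. -/

import Mathlib

/-- Projection of `φ : K^T → W` onto `S`, encoded on full labelings. -/
noncomputable def proj {T K W : Type*} [Fintype T] [Fintype K] [DecidableEq T] [DecidableEq K]
    [LinearOrder W] (S : Finset T) (φ : (T → K) → W) (x : T → K) : W :=
  Finset.inf' (Finset.univ.filter (fun y : T → K => ∀ i ∈ S, y i = x i))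
    ⟨x, by simp⟩ φ

/-- If every pair of coordinates of `x` extends to a labeling in the sublevel set of `φ` at `M`,
then so does every finite set of coordinates. -/
theorem exists_agreeing_le_of_pairs {T K W : Type*} [DecidableEq T] [LinearOrder W]
    (p : T → K → K → K → K)
    (hmaj : ∀ i : T, ∀ x y : K, p i y x x = x ∧ p i x y x = x ∧ p i x x y = x)
    (φ : (T → K) → W)
    (hinv : ∀ x y z : T → K,
      φ (fun i => p i (x i) (y i) (z i)) ≤ max (max (φ x) (φ y)) (φ z))
    (x : T → K) (M : W)
    (hpair : ∀ i j : T, ∃ y : T → K, y i = x i ∧ y j = x j ∧ φ y ≤ M)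
    [Nonempty T] (S : Finset T) :
    ∃ y : T → K, (∀ i ∈ S, y i = x i) ∧ φ y ≤ M := by
  induction S using Finset.strongInduction with
  | H S ih =>
    by_cases hS : 2 < S.card
    · obtain ⟨a, b, c, ha, hb, hc, hab, hac, hbc⟩ := Finset.two_lt_card_iff.mp hS
      obtain ⟨u, hu, huM⟩ := ih _ (Finset.erase_ssubset ha)
      obtain ⟨v, hv, hvM⟩ := ih _ (Finset.erase_ssubset hb)
      obtain ⟨w, hw, hwM⟩ := ih _ (Finset.erase_ssubset hc)
      refine ⟨fun i => p i (u i) (v i) (w i), fun i hi => ?_,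
        (hinv u v w).trans (max_le (max_le huM hvM) hwM)⟩
      simp only [Finset.mem_erase] at hu hv hw
      by_cases hia : i = a
      · subst hia
        simp only [hv i ⟨hab, hi⟩, hw i ⟨hac, hi⟩]
        exact (hmaj i (x i) (u i)).1
      · by_cases hib : i = b
        · subst hib
          simp only [hu i ⟨hia, hi⟩, hw i ⟨hbc, hi⟩]
          exact (hmaj i (x i) (v i)).2.1
        · simp only [hu i ⟨hia, hi⟩, hv i ⟨hib, hi⟩]
          exact (hmaj i (x i) (w i)).2.2
    · obtain ⟨i, j, hij⟩ : ∃ i j : T, S ⊆ {i, j} := by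
        rcases S.eq_empty_or_nonempty with rfl | ⟨i, hi⟩
        · exact ⟨Classical.arbitrary T, Classical.arbitrary T, Finset.empty_subset _⟩
        · by_cases h : ∃ j ∈ S, j ≠ i
          · obtain ⟨j, hj, hji⟩ := h
            refine ⟨i, j, fun k hk => ?_⟩
            by_contra hkij
            simp only [Finset.mem_insert, Finset.mem_singleton, not_or] at hkij
            exact hS (Finset.two_lt_card_iff.mpr
              ⟨i, j, k, hi, hj, hk, hji.symm, Ne.symm hkij.1, Ne.symm hkij.2⟩)
          · push Not at h
            exact ⟨i, i, fun k hk => by simp [h k hk]⟩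
      obtain ⟨y, hyi, hyj, hyM⟩ := hpair i j
      refine ⟨y, fun k hk => ?_, hyM⟩
      have hk := hij hk
      simp only [Finset.mem_insert, Finset.mem_singleton] at hk
      rcases hk with rfl | rfl <;> assumption

/-- a function with a majority polymorphism is the maximum of its
binary projections: `φ(x̄) = max_{i,j ∈ T} φ_{ij}(x_i, x_j)`. -/
theorem binary_decomposition {T K W : Type*} [Fintype T] [Fintype K] [DecidableEq T]
    [DecidableEq K] [Nonempty T] [Nonempty K] [LinearOrder W]
    (hT : 2 ≤ Fintype.card T) (p : T → K → K → K → K)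
    (hmaj : ∀ i : T, ∀ x y : K, p i y x x = x ∧ p i x y x = x ∧ p i x x y = x)
    (φ : (T → K) → W)
    (hinv : ∀ x y z : T → K,
      φ (fun i => p i (x i) (y i) (z i)) ≤ max (max (φ x) (φ y)) (φ z))
    (x : T → K) :
    φ x = Finset.sup' (Finset.univ ×ˢ Finset.univ) (by simp [Finset.univ_nonempty])
      (fun ij : T × T => proj {ij.1, ij.2} φ x) := by
  apply le_antisymm
  · set M := Finset.sup' (Finset.univ ×ˢ Finset.univ) (by simp [Finset.univ_nonempty])
      (fun ij : T × T => proj {ij.1, ij.2} φ x) with hM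
    have hpair : ∀ i j : T, ∃ y : T → K, y i = x i ∧ y j = x j ∧ φ y ≤ M := by
      intro i j
      have hle : proj {i, j} φ x ≤ M :=
        Finset.le_sup' (fun ij : T × T => proj {ij.1, ij.2} φ x) (b := (i, j)) (by simp)
      obtain ⟨y, hy, hyM⟩ := Finset.inf'_le_iff _ |>.mp hle
      simp only [Finset.mem_filter, Finset.mem_univ, true_and] at hy
      exact ⟨y, hy i (by simp), hy j (by simp), hyM⟩
    obtain ⟨y, hy, hyM⟩ :=
      exists_agreeing_le_of_pairs p hmaj φ hinv x M hpair Finset.univ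
    rwa [funext fun i => hy i (Finset.mem_univ i)] at hyM
  · exact Finset.sup'_le _ _ fun ij _ => Finset.inf'_le _ (by simp)
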